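/- In any n-dimensional 2-symmetric semi-Riemannian manifold of any signature, the symmetrized first derivative of the Riemann tensor annihilates the first derivatives of the curvature tensors: ∇_(τ R^{ρ}_{ν)λμ} ∇_ρ R_{αβγδ} = 0, ∇_(τ R^{ρ}_{ν)λμ} ∇_ρ C_{αβγδ} = 0, and ∇_(τ R^{ρ}_{ν)λμ} ∇_ρ R_{αβ} = 0, where C is the Weyl tensor and round brackets denote symmetrization. -/

import Mathlib

noncomputable section

open scoped BigOperators

/-! ## A local-coordinate framework for semi-Riemannian geometry

A semi-Riemannian manifold is described in a local chart: points are elements of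
`Pt n := Fin n → ℝ`, a rank-`q` covariant tensor field is a map
`Pt n → (Fin q → Fin n) → ℝ`, the metric `g` (with inverse `ginv`) determines the
Christoffel symbols of its Levi-Civita connection, the covariant derivative `covD`,
and the Riemann, Ricci, scalar and Weyl curvatures. -/

/-- Points of a local chart of an `n`-dimensional manifold. -/
abbrev Pt (n : ℕ) : Type := Fin n → ℝ

/-- A rank-`q` (covariant) tensor field, in the chart. -/
abbrev Tensor (n q : ℕ) : Type := Pt n → (Fin q → Fin n) → ℝ

/-- Partial derivative of a scalar field in the `i`-th coordinate direction. -/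
def pd {n : ℕ} (i : Fin n) (f : Pt n → ℝ) (x : Pt n) : ℝ :=
  fderiv ℝ f x (Pi.single i 1)

/-- `g` is a smooth metric of arbitrary signature, with (smooth) inverse `ginv`. -/
def IsMetric {n : ℕ} (g ginv : Pt n → Fin n → Fin n → ℝ) : Prop :=
  (∀ x μ ν, g x μ ν = g x ν μ) ∧
  (∀ μ ν, ContDiff ℝ (⊤ : ℕ∞) fun x => g x μ ν) ∧
  (∀ μ ν, ContDiff ℝ (⊤ : ℕ∞) fun x => ginv x μ ν) ∧
  (∀ x μ ν, (∑ ρ, ginv x μ ρ * g x ρ ν) = if μ = ν then (1 : ℝ) else 0)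

/-- The metric `g` has Lorentzian signature `(-,+,…,+)`: at every point there is a
frame in which it takes the form `diag (-1, 1, …, 1)`. -/
def IsLorentzian {n : ℕ} (g : Pt n → Fin n → Fin n → ℝ) : Prop :=
  ∀ x, ∃ e : Fin n → Fin n → ℝ, ∀ μ ν : Fin n,
    (∑ α, ∑ β, g x α β * e μ α * e ν β) =
      if μ = ν then (if μ.val = 0 then (-1 : ℝ) else 1) else 0

/-- Christoffel symbols `Γ^α_{βγ}` of the Levi-Civita connection of `g`. -/
def christoffel {n : ℕ} (g ginv : Pt n → Fin n → Fin n → ℝ) (x : Pt n) (α β γ : Fin n) : ℝ :=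
  (1 / 2) * ∑ ρ, ginv x α ρ *
    (pd β (fun y => g y ρ γ) x + pd γ (fun y => g y ρ β) x - pd ρ (fun y => g y β γ) x)

/-- Covariant derivative of a rank-`q` covariant tensor field:
`(covD T)_{λ α₁ … α_q} = ∇_λ T_{α₁ … α_q}`; the derivative index comes first. -/
def covD {n q : ℕ} (g ginv : Pt n → Fin n → Fin n → ℝ) (T : Tensor n q) :
    Tensor n (q + 1) := fun x idx =>
  pd (idx 0) (fun y => T y fun i => idx i.succ) x -
    ∑ i : Fin q, ∑ ρ, christoffel g ginv x ρ (idx 0) (idx i.succ) *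
      T x (Function.update (fun j => idx j.succ) i ρ)

/-- Covariant derivative `∇_λ k^μ` of a vector field `k^μ`. -/
def covDVec {n : ℕ} (g ginv : Pt n → Fin n → Fin n → ℝ) (k : Pt n → Fin n → ℝ)
    (x : Pt n) (lam μ : Fin n) : ℝ :=
  pd lam (fun y => k y μ) x + ∑ ρ, christoffel g ginv x μ lam ρ * k x ρ

/-- Riemann curvature tensor `R^α_{βγδ}` of the Levi-Civita connection of `g`. -/
def riemannUp {n : ℕ} (g ginv : Pt n → Fin n → Fin n → ℝ) (x : Pt n) (α β γ δ : Fin n) : ℝ :=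
  pd γ (fun y => christoffel g ginv y α δ β) x - pd δ (fun y => christoffel g ginv y α γ β) x +
    ∑ ρ, (christoffel g ginv x α γ ρ * christoffel g ginv x ρ δ β -
          christoffel g ginv x α δ ρ * christoffel g ginv x ρ γ β)

/-- Fully covariant Riemann tensor `R_{αβγδ} = g_{αρ} R^ρ_{βγδ}`. -/
def riemann {n : ℕ} (g ginv : Pt n → Fin n → Fin n → ℝ) : Tensor n 4 := fun x idx =>
  ∑ ρ, g x (idx 0) ρ * riemannUp g ginv x ρ (idx 1) (idx 2) (idx 3)

/-- Ricci tensor `R_{μν} = R^ρ_{μρν}`. -/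
def ricci {n : ℕ} (g ginv : Pt n → Fin n → Fin n → ℝ) : Tensor n 2 := fun x idx =>
  ∑ ρ, riemannUp g ginv x ρ (idx 0) ρ (idx 1)

/-- Scalar curvature `R = g^{μν} R_{μν}`. -/
def scalarCurv {n : ℕ} (g ginv : Pt n → Fin n → Fin n → ℝ) (x : Pt n) : ℝ :=
  ∑ μ, ∑ ν, ginv x μ ν * ricci g ginv x ![μ, ν]

/-- Weyl conformal tensor `C_{αβλμ}`, defined through the standard decomposition
`R_{αβλμ} = C_{αβλμ} + (2/(n-2)) (R_{α[λ} g_{μ]β} - R_{β[λ} g_{μ]α})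
 - (R/((n-1)(n-2))) (g_{αλ} g_{βμ} - g_{αμ} g_{βλ})`. -/
def weyl {n : ℕ} (g ginv : Pt n → Fin n → Fin n → ℝ) : Tensor n 4 := fun x idx =>
  riemann g ginv x idx -
    (2 / ((n : ℝ) - 2)) *
      ((ricci g ginv x ![idx 0, idx 2] * g x (idx 3) (idx 1) -
        ricci g ginv x ![idx 0, idx 3] * g x (idx 2) (idx 1)) / 2 -
       (ricci g ginv x ![idx 1, idx 2] * g x (idx 3) (idx 0) -
        ricci g ginv x ![idx 1, idx 3] * g x (idx 2) (idx 0)) / 2) +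
    (scalarCurv g ginv x / (((n : ℝ) - 1) * ((n : ℝ) - 2))) *
      (g x (idx 0) (idx 2) * g x (idx 1) (idx 3) - g x (idx 0) (idx 3) * g x (idx 1) (idx 2))

/-- Second-order symmetry (2-symmetry): `∇_μ ∇_ν R_{αβγδ} = 0` everywhere. -/
def TwoSymmetric {n : ℕ} (g ginv : Pt n → Fin n → Fin n → ℝ) : Prop :=
  ∀ x idx, covD g ginv (covD g ginv (riemann g ginv)) x idx = 0

/-- 2-symmetry on a set `D`: `∇_μ ∇_ν R_{αβγδ} = 0` on `D`. -/
def TwoSymmetricOn {n : ℕ} (g ginv : Pt n → Fin n → Fin n → ℝ) (D : Set (Pt n)) : Prop :=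
  ∀ x ∈ D, ∀ idx, covD g ginv (covD g ginv (riemann g ginv)) x idx = 0

/-- Semi-symmetry: `∇_[μ ∇_ν] R_{αβγδ} = 0` everywhere. -/
def SemiSymmetric {n : ℕ} (g ginv : Pt n → Fin n → Fin n → ℝ) : Prop :=
  ∀ x (μ ν α β γ δ : Fin n),
    covD g ginv (covD g ginv (riemann g ginv)) x ![μ, ν, α, β, γ, δ] =
    covD g ginv (covD g ginv (riemann g ginv)) x ![ν, μ, α, β, γ, δ]

/-- `p` is a generic point: the Riemann tensor at `p`, viewed as the endomorphism
`ω_{γδ} ↦ R^{αβ}_{γδ} ω_{γδ}` of the space of 2-forms at `p`, is non-singular. -/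
def GenericAt {n : ℕ} (g ginv : Pt n → Fin n → Fin n → ℝ) (p : Pt n) : Prop :=
  ∀ ω : Fin n → Fin n → ℝ, (∀ γ δ, ω γ δ = -ω δ γ) →
    (∀ α β, (∑ γ, ∑ δ, (∑ σ, ginv p β σ * riemannUp g ginv p α σ γ δ) * ω γ δ) = 0) →
    ω = 0

/-- `k` is a parallel null (nowhere zero) vector field on `D`. -/
def ParallelNullVectorFieldOn {n : ℕ} (g ginv : Pt n → Fin n → Fin n → ℝ)
    (D : Set (Pt n)) (k : Pt n → Fin n → ℝ) : Prop :=
  (∀ x ∈ D, ∀ lam μ, covDVec g ginv k x lam μ = 0) ∧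
  (∀ x ∈ D, (∑ μ, ∑ ν, g x μ ν * k x μ * k x ν) = 0) ∧
  (∀ x ∈ D, k x ≠ 0)

/-- Pullback metric of `g` along a coordinate change `φ`. -/
def pullback {n : ℕ} (g : Pt n → Fin n → Fin n → ℝ) (φ : Pt n → Pt n)
    (x : Pt n) (μ ν : Fin n) : ℝ :=
  ∑ α, ∑ β, g (φ x) α β * pd μ (fun y => φ y α) x * pd ν (fun y => φ y β) x

/-- `k`-th iterated covariant derivative of a rank-`q` tensor field. -/
def covDIter {n : ℕ} (g ginv : Pt n → Fin n → Fin n → ℝ) (q : ℕ) :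
    (k : ℕ) → Tensor n q → Tensor n (q + k)
  | 0, T => T
  | k + 1, T => covD g ginv (covDIter g ginv q k T)

/-- Totally antisymmetric Levi-Civita symbol. -/
def lcSymbol {n : ℕ} (idx : Fin n → Fin n) : ℝ :=
  if h : Function.Bijective idx then ((Equiv.Perm.sign (Equiv.ofBijective idx h) : ℤ) : ℝ) else 0

/-- The metric volume element `n`-form `√|det g| ε_{μ₁…μ_n}`. -/
def volForm {n : ℕ} (g : Pt n → Fin n → Fin n → ℝ) : Tensor n n := fun x idx =>
  Real.sqrt |Matrix.det (Matrix.of (g x))| * lcSymbol idx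

/-- Formal curvature invariants of rank `q`: tensor fields constructed polynomially
from the metric, its inverse, the Riemann tensor, the volume `n`-form, covariant
derivatives, tensor products, (metric) contractions, index permutations, sums and
scalar multiples. -/
inductive TExpr (n : ℕ) : ℕ → Type where
  | metric : TExpr n 2
  | inv : TExpr n 2
  | riem : TExpr n 4
  | eps : TExpr n n
  | cd : {q : ℕ} → TExpr n q → TExpr n (q + 1)
  | tprod : {q r : ℕ} → TExpr n q → TExpr n r → TExpr n (q + r)
  | contr : {q : ℕ} → TExpr n (q + 2) → TExpr n q
  | permute : {q : ℕ} → Equiv.Perm (Fin q) → TExpr n q → TExpr n q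
  | add : {q : ℕ} → TExpr n q → TExpr n q → TExpr n q
  | smul : {q : ℕ} → ℝ → TExpr n q → TExpr n q

/-- Evaluation of a formal curvature invariant as a tensor field. -/
def TExpr.eval {n : ℕ} (g ginv : Pt n → Fin n → Fin n → ℝ) :
    {q : ℕ} → TExpr n q → Tensor n q
  | _, .metric => fun x idx => g x (idx 0) (idx 1)
  | _, .inv => fun x idx => ginv x (idx 0) (idx 1)
  | _, .riem => riemann g ginv
  | _, .eps => volForm g
  | _, .cd e => covD g ginv (TExpr.eval g ginv e)
  | _, .tprod e₁ e₂ => fun x idx =>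
      TExpr.eval g ginv e₁ x (fun i => idx (Fin.castAdd _ i)) *
      TExpr.eval g ginv e₂ x (fun i => idx (Fin.natAdd _ i))
  | _, .contr e => fun x idx =>
      ∑ ρ, ∑ σ, ginv x ρ σ * TExpr.eval g ginv e x (Fin.cons ρ (Fin.cons σ idx))
  | _, .permute π e => fun x idx => TExpr.eval g ginv e x (idx ∘ π)
  | _, .add e₁ e₂ => fun x idx => TExpr.eval g ginv e₁ x idx + TExpr.eval g ginv e₂ x idx
  | _, .smul c e => fun x idx => c * TExpr.eval g ginv e x idx

/-- `e.HasOrderDeg m d`: the invariant `e` is homogeneous of order `m` (number of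
covariant derivatives in each term) and degree `d` (number of Riemann factors in
each term). -/
inductive TExpr.HasOrderDeg {n : ℕ} : {q : ℕ} → TExpr n q → ℕ → ℕ → Prop where
  | metric : HasOrderDeg .metric 0 0
  | inv : HasOrderDeg .inv 0 0
  | riem : HasOrderDeg .riem 0 1
  | eps : HasOrderDeg .eps 0 0
  | cd {q : ℕ} {e : TExpr n q} {m d : ℕ} : HasOrderDeg e m d → HasOrderDeg e.cd (m + 1) d
  | tprod {q r : ℕ} {e₁ : TExpr n q} {e₂ : TExpr n r} {m₁ d₁ m₂ d₂ : ℕ} :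
      HasOrderDeg e₁ m₁ d₁ → HasOrderDeg e₂ m₂ d₂ →
      HasOrderDeg (e₁.tprod e₂) (m₁ + m₂) (d₁ + d₂)
  | contr {q : ℕ} {e : TExpr n (q + 2)} {m d : ℕ} : HasOrderDeg e m d → HasOrderDeg e.contr m d
  | permute {q : ℕ} {π : Equiv.Perm (Fin q)} {e : TExpr n q} {m d : ℕ} :
      HasOrderDeg e m d → HasOrderDeg (e.permute π) m d
  | add {q : ℕ} {e₁ e₂ : TExpr n q} {m d : ℕ} :
      HasOrderDeg e₁ m d → HasOrderDeg e₂ m d → HasOrderDeg (e₁.add e₂) m d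
  | smul {q : ℕ} {c : ℝ} {e : TExpr n q} {m d : ℕ} :
      HasOrderDeg e m d → HasOrderDeg (e.smul c) m d

/-- `P` is the parallel-transport operator along the curve `γ`. -/
def IsTransportAlong {n : ℕ} (g ginv : Pt n → Fin n → Fin n → ℝ)
    (γ : ℝ → Pt n) (P : ℝ → Fin n → Fin n → ℝ) : Prop :=
  (∀ μ ν, P 0 μ ν = if μ = ν then (1 : ℝ) else 0) ∧
  ∀ t μ ν, HasDerivAt (fun s => P s μ ν)
    (-∑ lam, ∑ ρ, christoffel g ginv (γ t) μ lam ρ * deriv (fun s => γ s lam) t * P t ρ ν) t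

/-- The subspace `W` of the tangent space at `p` is invariant under the holonomy
group of `(D, g)` at `p` (parallel transport around smooth loops in `D` based at `p`). -/
def HolonomyInvariantAt {n : ℕ} (g ginv : Pt n → Fin n → Fin n → ℝ) (D : Set (Pt n))
    (p : Pt n) (W : Submodule ℝ (Fin n → ℝ)) : Prop :=
  ∀ γ : ℝ → Pt n, ContDiff ℝ (⊤ : ℕ∞) γ → (∀ t, γ t ∈ D) → γ 0 = p → γ 1 = p →
    ∀ P, IsTransportAlong g ginv γ P →
      ∀ w ∈ W, (fun μ => ∑ ν, P 1 μ ν * w ν) ∈ W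

/-- The holonomy group of `(D,g)` at `p` is reducible: it leaves invariant a
non-trivial subspace of the tangent space. -/
def ReducibleAt {n : ℕ} (g ginv : Pt n → Fin n → Fin n → ℝ) (D : Set (Pt n))
    (p : Pt n) : Prop :=
  ∃ W : Submodule ℝ (Fin n → ℝ), W ≠ ⊥ ∧ W ≠ ⊤ ∧ HolonomyInvariantAt g ginv D p W

/-- The holonomy group of `(D,g)` at `p` is non-degenerately reducible: it leaves
invariant a non-trivial subspace on which `g` is non-degenerate. -/
def NonDegReducibleAt {n : ℕ} (g ginv : Pt n → Fin n → Fin n → ℝ) (D : Set (Pt n))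
    (p : Pt n) : Prop :=
  ∃ W : Submodule ℝ (Fin n → ℝ), W ≠ ⊥ ∧ W ≠ ⊤ ∧ HolonomyInvariantAt g ginv D p W ∧
    ∀ w ∈ W, (∀ u ∈ W, (∑ μ, ∑ ν, g p μ ν * w μ * u ν) = 0) → w = 0


section TensorAction

variable {n q : ℕ}

/-- The derivation action of an endomorphism `A` on a covariant tensor. -/
def derivAct (A : Matrix (Fin n) (Fin n) ℝ) (T : (Fin q → Fin n) → ℝ) :
    (Fin q → Fin n) → ℝ := fun idx =>
  ∑ i, ∑ ρ, A ρ (idx i) * T (Function.update idx i ρ)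

lemma derivAct_cons (A : Matrix (Fin n) (Fin n) ℝ) (T : (Fin (q + 1) → Fin n) → ℝ)
    (ν : Fin n) (idx : Fin q → Fin n) :
    derivAct A T (Fin.cons ν idx) =
      ∑ ρ, A ρ ν * T (Fin.cons ρ idx) + derivAct A (fun idx => T (Fin.cons ν idx)) idx := by
  simp only [derivAct, Fin.sum_univ_succ, Fin.cons_zero, Fin.cons_succ, Fin.update_cons_zero,
    Fin.cons_update]

lemma derivAct_vecCons (A : Matrix (Fin n) (Fin n) ℝ) (T : (Fin (q + 1) → Fin n) → ℝ)
    (ν : Fin n) (idx : Fin q → Fin n) :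
    derivAct A T (Matrix.vecCons ν idx) =
      ∑ ρ, A ρ ν * T (Matrix.vecCons ρ idx) +
        derivAct A (fun idx => T (Matrix.vecCons ν idx)) idx :=
  derivAct_cons A T ν idx

lemma derivAct_rank_zero (A : Matrix (Fin n) (Fin n) ℝ) (T : (Fin 0 → Fin n) → ℝ)
    (idx : Fin 0 → Fin n) : derivAct A T idx = 0 := by
  simp [derivAct]

lemma derivAct_add_left (A B : Matrix (Fin n) (Fin n) ℝ) (T : (Fin q → Fin n) → ℝ) :
    derivAct (A + B) T = derivAct A T + derivAct B T := by
  ext idx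
  simp [derivAct, add_mul, Finset.sum_add_distrib]

lemma derivAct_smul_left (c : ℝ) (A : Matrix (Fin n) (Fin n) ℝ) (T : (Fin q → Fin n) → ℝ) :
    derivAct (c • A) T = c • derivAct A T := by
  ext idx
  simp [derivAct, mul_assoc, Finset.mul_sum]

lemma derivAct_sub_left (A B : Matrix (Fin n) (Fin n) ℝ) (T : (Fin q → Fin n) → ℝ) :
    derivAct (A - B) T = derivAct A T - derivAct B T := by
  ext idx
  simp [derivAct, sub_mul, Finset.sum_sub_distrib]

lemma derivAct_zero_left (T : (Fin q → Fin n) → ℝ) : derivAct 0 T = 0 := by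
  ext idx
  simp [derivAct]

lemma derivAct_sum_left {ι : Type*} (s : Finset ι) (A : ι → Matrix (Fin n) (Fin n) ℝ)
    (T : (Fin q → Fin n) → ℝ) :
    derivAct (∑ i ∈ s, A i) T = ∑ i ∈ s, derivAct (A i) T := by
  classical
  induction s using Finset.induction_on with
  | empty => simp [derivAct_zero_left]
  | insert a s ha ih => simp [Finset.sum_insert ha, derivAct_add_left, ih]

lemma derivAct_add_right (A : Matrix (Fin n) (Fin n) ℝ) (S T : (Fin q → Fin n) → ℝ) :
    derivAct A (S + T) = derivAct A S + derivAct A T := by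
  ext idx
  simp [derivAct, mul_add, Finset.sum_add_distrib]

lemma derivAct_sub_right (A : Matrix (Fin n) (Fin n) ℝ) (S T : (Fin q → Fin n) → ℝ) :
    derivAct A (S - T) = derivAct A S - derivAct A T := by
  ext idx
  simp [derivAct, mul_sub, Finset.sum_sub_distrib]

lemma derivAct_smul_right (c : ℝ) (A : Matrix (Fin n) (Fin n) ℝ) (T : (Fin q → Fin n) → ℝ) :
    derivAct A (c • T) = c • derivAct A T := by
  ext idx
  simp [derivAct, Finset.mul_sum, mul_left_comm]

lemma derivAct_zero_right (A : Matrix (Fin n) (Fin n) ℝ) :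
    derivAct A (0 : (Fin q → Fin n) → ℝ) = 0 := by
  ext idx
  simp [derivAct]

lemma derivAct_sum_right {ι : Type*} (s : Finset ι) (A : Matrix (Fin n) (Fin n) ℝ)
    (T : ι → (Fin q → Fin n) → ℝ) :
    derivAct A (∑ i ∈ s, T i) = ∑ i ∈ s, derivAct A (T i) := by
  classical
  induction s using Finset.induction_on with
  | empty => simp [derivAct_zero_right]
  | insert a s ha ih => simp [Finset.sum_insert ha, derivAct_add_right, ih]

lemma derivAct_commutator (A B : Matrix (Fin n) (Fin n) ℝ) (T : (Fin q → Fin n) → ℝ) :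
    derivAct A (derivAct B T) - derivAct B (derivAct A T) = derivAct (B * A - A * B) T := by
  induction q with
  | zero => ext idx; simp [derivAct]
  | succ q ih =>
    ext idx
    obtain ⟨ν, idx, rfl⟩ : ∃ ν idx', idx = Fin.cons ν idx' :=
      ⟨idx 0, Fin.tail idx, (Fin.cons_self_tail idx).symm⟩
    have key := congrFun (ih (fun idx => T (Fin.cons ν idx))) idx
    have expand : ∀ A B : Matrix (Fin n) (Fin n) ℝ,
        derivAct A (derivAct B T) (Fin.cons ν idx) =
          ∑ σ, (B * A) σ ν * T (Fin.cons σ idx) +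
          ∑ ρ, A ρ ν * derivAct B (fun idx => T (Fin.cons ρ idx)) idx +
          ∑ ρ, B ρ ν * derivAct A (fun idx => T (Fin.cons ρ idx)) idx +
          derivAct A (derivAct B (fun idx => T (Fin.cons ν idx))) idx := by
      intro A B
      have h : (fun idx => derivAct B T (Fin.cons ν idx)) =
          ∑ ρ, B ρ ν • (fun idx => T (Fin.cons ρ idx)) +
            derivAct B (fun idx => T (Fin.cons ν idx)) := by
        ext idx
        simp [derivAct_cons]
      rw [derivAct_cons, h, derivAct_add_right, derivAct_sum_right]
      simp only [derivAct_cons, derivAct_smul_right, mul_add, Finset.sum_add_distrib,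
        Pi.add_apply, Finset.sum_apply, Pi.smul_apply, smul_eq_mul, Matrix.mul_apply,
        Finset.sum_mul, Finset.mul_sum]
      rw [Finset.sum_comm]
      simp only [mul_assoc, mul_comm]
      ring
    simp only [Pi.sub_apply] at key ⊢
    rw [expand A B, expand B A, derivAct_cons, ← key]
    simp only [Matrix.sub_apply, sub_mul, Finset.sum_sub_distrib]
    ring

end TensorAction

section PartialDerivatives

variable {n : ℕ}

lemma pd_add {f h : Pt n → ℝ} {x : Pt n} (i : Fin n) (hf : DifferentiableAt ℝ f x)
    (hh : DifferentiableAt ℝ h x) : pd i (fun y => f y + h y) x = pd i f x + pd i h x := by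
  simp [pd, fderiv_fun_add hf hh]

lemma pd_sub {f h : Pt n → ℝ} {x : Pt n} (i : Fin n) (hf : DifferentiableAt ℝ f x)
    (hh : DifferentiableAt ℝ h x) : pd i (fun y => f y - h y) x = pd i f x - pd i h x := by
  simp [pd, fderiv_fun_sub hf hh]

lemma pd_mul {f h : Pt n → ℝ} {x : Pt n} (i : Fin n) (hf : DifferentiableAt ℝ f x)
    (hh : DifferentiableAt ℝ h x) :
    pd i (fun y => f y * h y) x = pd i f x * h x + f x * pd i h x := by
  simp [pd, fderiv_fun_mul hf hh]
  ring

lemma pd_sum {ι : Type*} (s : Finset ι) {f : ι → Pt n → ℝ} {x : Pt n} (i : Fin n)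
    (hf : ∀ j ∈ s, DifferentiableAt ℝ (f j) x) :
    pd i (fun y => ∑ j ∈ s, f j y) x = ∑ j ∈ s, pd i (f j) x := by
  simp [pd, fderiv_fun_sum hf]

lemma pd_const (i : Fin n) (c : ℝ) (x : Pt n) : pd i (fun _ => c) x = 0 := by
  simp [pd]

lemma contDiff_pd {f : Pt n → ℝ} (hf : ContDiff ℝ (⊤ : ℕ∞) f) (i : Fin n) :
    ContDiff ℝ (⊤ : ℕ∞) (pd i f) :=
  (hf.fderiv_right (m := (⊤ : ℕ∞)) (by simp)).clm_apply contDiff_const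

lemma pd_comm {f : Pt n → ℝ} (hf : ContDiff ℝ (⊤ : ℕ∞) f) (i j : Fin n) (x : Pt n) :
    pd i (pd j f) x = pd j (pd i f) x := by
  have hd : DifferentiableAt ℝ (fderiv ℝ f) x :=
    ((hf.fderiv_right (m := (⊤ : ℕ∞)) (by simp)).differentiable (by simp)).differentiableAt
  have h : ∀ i j : Fin n, pd i (pd j f) x =
      fderiv ℝ (fderiv ℝ f) x (Pi.single i 1) (Pi.single j 1) := by
    intro i j
    change fderiv ℝ (fun y => fderiv ℝ f y (Pi.single j 1)) x (Pi.single i 1) = _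
    rw [fderiv_clm_apply hd (differentiableAt_const _)]
    simp
  rw [h, h]
  exact (hf.contDiffAt.isSymmSndFDerivAt (by simpa using WithTop.coe_le_coe.2 (le_top (a := (2 : ℕ∞))))).eq _ _

end PartialDerivatives

section CovariantDerivative

variable {n q : ℕ} {g ginv : Pt n → Fin n → Fin n → ℝ}

/-- The connection form of the Levi-Civita connection evaluated on the `τ`-th coordinate
vector, as an endomorphism field. -/
def connEnd (g ginv : Pt n → Fin n → Fin n → ℝ) (τ : Fin n) (x : Pt n) :
    Matrix (Fin n) (Fin n) ℝ := Matrix.of fun α β => christoffel g ginv x α τ β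

/-- The curvature endomorphism field attached to the `γ`-th and `δ`-th coordinate vectors. -/
def curvEnd (g ginv : Pt n → Fin n → Fin n → ℝ) (γ δ : Fin n) (x : Pt n) :
    Matrix (Fin n) (Fin n) ℝ := Matrix.of fun α β => riemannUp g ginv x α β γ δ

/-- The covariant derivative of a tensor field along the `τ`-th coordinate vector field. -/
def covDAlong (g ginv : Pt n → Fin n → Fin n → ℝ) (τ : Fin n) (T : Tensor n q) : Tensor n q :=
  fun x idx => covD g ginv T x (Fin.cons τ idx)

/-- The covariant derivative of an endomorphism field along the `τ`-th coordinate vector field. -/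
def covDEnd (g ginv : Pt n → Fin n → Fin n → ℝ) (τ : Fin n)
    (M : Pt n → Matrix (Fin n) (Fin n) ℝ) (x : Pt n) : Matrix (Fin n) (Fin n) ℝ :=
  Matrix.of (fun α β => pd τ (fun y => M y α β) x) +
    (connEnd g ginv τ x * M x - M x * connEnd g ginv τ x)

/-- All components of the tensor field are smooth functions. -/
def SmoothTensor (T : Tensor n q) : Prop := ∀ idx, ContDiff ℝ (⊤ : ℕ∞) fun x => T x idx

/-- All entries of the endomorphism field are smooth functions. -/
def SmoothEnd (M : Pt n → Matrix (Fin n) (Fin n) ℝ) : Prop :=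
  ∀ α β, ContDiff ℝ (⊤ : ℕ∞) fun x => M x α β

lemma SmoothTensor.differentiableAt {T : Tensor n q} (hT : SmoothTensor T)
    (idx : Fin q → Fin n) (x : Pt n) : DifferentiableAt ℝ (fun y => T y idx) x :=
  ((hT idx).differentiable (by simp)).differentiableAt

lemma SmoothEnd.differentiableAt {M : Pt n → Matrix (Fin n) (Fin n) ℝ} (hM : SmoothEnd M)
    (α β : Fin n) (x : Pt n) : DifferentiableAt ℝ (fun y => M y α β) x :=
  ((hM α β).differentiable (by simp)).differentiableAt

lemma SmoothEnd.derivAct {M : Pt n → Matrix (Fin n) (Fin n) ℝ} {T : Tensor n q}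
    (hM : SmoothEnd M) (hT : SmoothTensor T) : SmoothTensor fun x => derivAct (M x) (T x) :=
  fun _ => ContDiff.sum fun _ _ => ContDiff.sum fun _ _ => (hM _ _).mul (hT _)

lemma covDAlong_apply (τ : Fin n) (T : Tensor n q) (x : Pt n) (idx : Fin q → Fin n) :
    covDAlong g ginv τ T x idx =
      pd τ (fun y => T y idx) x - derivAct (connEnd g ginv τ x) (T x) idx := rfl

lemma contDiff_christoffel (hg : IsMetric g ginv) (α β γ : Fin n) :
    ContDiff ℝ (⊤ : ℕ∞) fun x => christoffel g ginv x α β γ :=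
  contDiff_const.mul <| ContDiff.sum fun _ _ => (hg.2.2.1 _ _).mul <|
    ((contDiff_pd (hg.2.1 _ _) _).add (contDiff_pd (hg.2.1 _ _) _)).sub
      (contDiff_pd (hg.2.1 _ _) _)

lemma smoothEnd_connEnd (hg : IsMetric g ginv) (τ : Fin n) : SmoothEnd (connEnd g ginv τ) :=
  fun _ _ => contDiff_christoffel hg _ _ _

lemma contDiff_riemannUp (hg : IsMetric g ginv) (α β γ δ : Fin n) :
    ContDiff ℝ (⊤ : ℕ∞) fun x => riemannUp g ginv x α β γ δ := by
  have hΓ := contDiff_christoffel hg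
  exact ((contDiff_pd (hΓ _ _ _) _).sub (contDiff_pd (hΓ _ _ _) _)).add <|
    ContDiff.sum fun _ _ => ((hΓ _ _ _).mul (hΓ _ _ _)).sub ((hΓ _ _ _).mul (hΓ _ _ _))

lemma smoothTensor_riemann (hg : IsMetric g ginv) : SmoothTensor (riemann g ginv) :=
  fun _ => ContDiff.sum fun _ _ => (hg.2.1 _ _).mul (contDiff_riemannUp hg _ _ _ _)

lemma SmoothTensor.covDAlong (hg : IsMetric g ginv) {T : Tensor n q} (hT : SmoothTensor T)
    (τ : Fin n) : SmoothTensor (covDAlong g ginv τ T) :=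
  fun idx => (contDiff_pd (hT idx) τ).sub ((smoothEnd_connEnd hg τ).derivAct hT idx)

lemma SmoothTensor.covD (hg : IsMetric g ginv) {T : Tensor n q} (hT : SmoothTensor T) :
    SmoothTensor (covD g ginv T) := fun idx => by
  have h := hT.covDAlong hg (idx 0) (Fin.tail idx)
  simpa only [_root_.covDAlong, Fin.cons_self_tail] using h

lemma christoffel_symm (hg : IsMetric g ginv) (x : Pt n) (α β γ : Fin n) :
    christoffel g ginv x α β γ = christoffel g ginv x α γ β := by
  refine congrArg _ (Finset.sum_congr rfl fun ρ _ => ?_)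
  rw [funext fun y => hg.1 y β γ]
  ring

lemma covDAlong_cons (τ ν : Fin n) (T : Tensor n (q + 1)) (x : Pt n) (idx : Fin q → Fin n) :
    covDAlong g ginv τ T x (Fin.cons ν idx) =
      covDAlong g ginv τ (fun y idx => T y (Fin.cons ν idx)) x idx -
        ∑ ρ, christoffel g ginv x ρ τ ν * T x (Fin.cons ρ idx) := by
  rw [covDAlong_apply, covDAlong_apply, derivAct_cons]
  simp only [connEnd, Matrix.of_apply]
  ring

lemma pd_derivAct {M : Pt n → Matrix (Fin n) (Fin n) ℝ} {T : Tensor n q}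
    (hM : SmoothEnd M) (hT : SmoothTensor T) (τ : Fin n) (x : Pt n) (idx : Fin q → Fin n) :
    pd τ (fun y => derivAct (M y) (T y) idx) x =
      derivAct (Matrix.of fun α β => pd τ (fun y => M y α β) x) (T x) idx +
        derivAct (M x) (fun idx => pd τ (fun y => T y idx) x) idx := by
  have hd : ∀ α β idx, DifferentiableAt ℝ (fun y => M y α β * T y idx) x := fun α β idx =>
    (hM.differentiableAt α β x).mul (hT.differentiableAt idx x)
  simp only [derivAct]
  rw [pd_sum _ _ fun i _ => DifferentiableAt.fun_sum fun ρ _ => hd _ _ _]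
  simp only [pd_sum _ _ fun ρ _ => hd _ _ _, pd_mul _ (hM.differentiableAt _ _ x)
    (hT.differentiableAt _ x), Finset.sum_add_distrib, Matrix.of_apply]

/-- The Leibniz rule for the action of an endomorphism field on a tensor field. -/
lemma covDAlong_derivAct {M : Pt n → Matrix (Fin n) (Fin n) ℝ} {T : Tensor n q}
    (hM : SmoothEnd M) (hT : SmoothTensor T) (τ : Fin n) (x : Pt n) :
    covDAlong g ginv τ (fun y => derivAct (M y) (T y)) x =
      derivAct (covDEnd g ginv τ M x) (T x) + derivAct (M x) (covDAlong g ginv τ T x) := by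
  have hT' : covDAlong g ginv τ T x =
      (fun idx => pd τ (fun y => T y idx) x) - derivAct (connEnd g ginv τ x) (T x) := rfl
  ext idx
  rw [covDAlong_apply, pd_derivAct hM hT, hT', derivAct_sub_right, covDEnd,
    derivAct_add_left, ← derivAct_commutator]
  simp only [Pi.add_apply, Pi.sub_apply]
  ring

/-- The Ricci identity for the coordinate vector fields. -/
lemma covDAlong_covDAlong_sub (hg : IsMetric g ginv) {T : Tensor n q} (hT : SmoothTensor T)
    (μ ν : Fin n) (x : Pt n) :
    covDAlong g ginv μ (covDAlong g ginv ν T) x - covDAlong g ginv ν (covDAlong g ginv μ T) x =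
      -derivAct (curvEnd g ginv μ ν x) (T x) := by
  have expand : ∀ μ ν idx, covDAlong g ginv μ (covDAlong g ginv ν T) x idx =
      pd μ (pd ν fun y => T y idx) x -
        derivAct (Matrix.of fun α β => pd μ (fun y => connEnd g ginv ν y α β) x) (T x) idx -
        derivAct (connEnd g ginv ν x) (fun idx => pd μ (fun y => T y idx) x) idx -
        derivAct (connEnd g ginv μ x) (fun idx => pd ν (fun y => T y idx) x) idx +
        derivAct (connEnd g ginv μ x) (derivAct (connEnd g ginv ν x) (T x)) idx := by
    intro μ ν idx
    have hν : covDAlong g ginv ν T x =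
      (fun idx => pd ν (fun y => T y idx) x) - derivAct (connEnd g ginv ν x) (T x) := rfl
    have hpd : pd μ (fun y => covDAlong g ginv ν T y idx) x =
        pd μ (pd ν fun y => T y idx) x -
          pd μ (fun y => derivAct (connEnd g ginv ν y) (T y) idx) x :=
      pd_sub μ ((contDiff_pd (hT idx) ν).differentiable (by simp)).differentiableAt
        (((smoothEnd_connEnd hg ν).derivAct hT).differentiableAt idx x)
    rw [covDAlong_apply, hpd, pd_derivAct (smoothEnd_connEnd hg ν) hT, hν, derivAct_sub_right]
    simp only [Pi.sub_apply]
    ring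
  have hcurv : curvEnd g ginv μ ν x =
      Matrix.of (fun α β => pd μ (fun y => connEnd g ginv ν y α β) x) -
        Matrix.of (fun α β => pd ν (fun y => connEnd g ginv μ y α β) x) -
        (connEnd g ginv ν x * connEnd g ginv μ x - connEnd g ginv μ x * connEnd g ginv ν x) := by
    ext α β
    simp [curvEnd, riemannUp, connEnd, Matrix.mul_apply, Finset.sum_sub_distrib]
    ring
  ext idx
  simp only [Pi.sub_apply, Pi.neg_apply]
  rw [expand, expand, hcurv, derivAct_sub_left, derivAct_sub_left, ← derivAct_commutator,
    pd_comm (hT idx)]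
  simp only [Pi.sub_apply]
  ring

lemma covD_covD_cons_cons (μ ν : Fin n) (T : Tensor n q) (x : Pt n) (idx : Fin q → Fin n) :
    covD g ginv (covD g ginv T) x (Fin.cons μ (Fin.cons ν idx)) =
      covDAlong g ginv μ (covDAlong g ginv ν T) x idx -
        ∑ ρ, christoffel g ginv x ρ μ ν * covDAlong g ginv ρ T x idx :=
  covDAlong_cons μ ν (covD g ginv T) x idx

/-- The curvature endomorphisms annihilate every tensor field whose second covariant
derivative vanishes. -/
lemma derivAct_curvEnd_eq_zero (hg : IsMetric g ginv) {T : Tensor n q} (hT : SmoothTensor T)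
    (h : ∀ x idx, covD g ginv (covD g ginv T) x idx = 0) (μ ν : Fin n) (x : Pt n) :
    derivAct (curvEnd g ginv μ ν x) (T x) = 0 := by
  have h1 := covDAlong_covDAlong_sub hg hT μ ν x
  ext idx
  have h2 := congrFun h1 idx
  have h3 := h x (Fin.cons μ (Fin.cons ν idx))
  have h4 := h x (Fin.cons ν (Fin.cons μ idx))
  rw [covD_covD_cons_cons] at h3 h4
  simp only [Pi.sub_apply, Pi.neg_apply] at h2
  simp only [christoffel_symm hg x _ ν μ] at h4
  simp only [Pi.zero_apply]
  linarith

end CovariantDerivative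

section MetricCompatibility

variable {n q : ℕ} {g ginv : Pt n → Fin n → Fin n → ℝ}

lemma IsMetric.inv_mul (hg : IsMetric g ginv) (x : Pt n) :
    Matrix.of (ginv x) * Matrix.of (g x) = 1 := by
  ext μ ν
  simpa [Matrix.mul_apply, Matrix.one_apply] using hg.2.2.2 x μ ν

lemma IsMetric.mul_inv (hg : IsMetric g ginv) (x : Pt n) :
    Matrix.of (g x) * Matrix.of (ginv x) = 1 :=
  mul_eq_one_comm.1 (hg.inv_mul x)

lemma IsMetric.inv_symm (hg : IsMetric g ginv) (x : Pt n) (μ ν : Fin n) :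
    ginv x μ ν = ginv x ν μ := by
  have hgT : (Matrix.of (g x)).transpose = Matrix.of (g x) := by
    ext μ ν
    exact hg.1 x ν μ
  have h := congrArg Matrix.transpose (hg.mul_inv x)
  rw [Matrix.transpose_mul, hgT, Matrix.transpose_one] at h
  have h' := left_inv_eq_right_inv h (hg.mul_inv x)
  exact (congrFun (congrFun h' ν) μ)

lemma IsMetric.differentiableAt (hg : IsMetric g ginv) (μ ν : Fin n) (x : Pt n) :
    DifferentiableAt ℝ (fun y => g y μ ν) x :=
  ((hg.2.1 μ ν).differentiable (by simp)).differentiableAt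

lemma IsMetric.differentiableAt_inv (hg : IsMetric g ginv) (μ ν : Fin n) (x : Pt n) :
    DifferentiableAt ℝ (fun y => ginv y μ ν) x :=
  ((hg.2.2.1 μ ν).differentiable (by simp)).differentiableAt

lemma sum_metric_mul_inv (hg : IsMetric g ginv) (x : Pt n) (κ : Fin n) (f : Fin n → ℝ) :
    ∑ α, g x κ α * ∑ ρ, ginv x α ρ * f ρ = f κ := by
  have h : (Matrix.of (g x)).mulVec ((Matrix.of (ginv x)).mulVec f) = f := by
    rw [Matrix.mulVec_mulVec, hg.mul_inv, Matrix.one_mulVec]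
  exact congrFun h κ

lemma sum_inv_mul_metric (hg : IsMetric g ginv) (x : Pt n) (κ : Fin n) (f : Fin n → ℝ) :
    ∑ α, ginv x κ α * ∑ ρ, g x α ρ * f ρ = f κ := by
  have h : (Matrix.of (ginv x)).mulVec ((Matrix.of (g x)).mulVec f) = f := by
    rw [Matrix.mulVec_mulVec, hg.inv_mul, Matrix.one_mulVec]
  exact congrFun h κ

/-- The Christoffel symbols of the first kind. -/
lemma sum_metric_mul_christoffel (hg : IsMetric g ginv) (x : Pt n) (κ β γ : Fin n) :
    ∑ α, g x κ α * christoffel g ginv x α β γ =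
      (1 / 2) * (pd β (fun y => g y κ γ) x + pd γ (fun y => g y κ β) x -
        pd κ (fun y => g y β γ) x) := by
  simp only [christoffel, mul_left_comm _ (1 / 2 : ℝ), ← Finset.mul_sum]
  rw [sum_metric_mul_inv hg x κ fun ρ => pd β (fun y => g y ρ γ) x + pd γ (fun y => g y ρ β) x -
        pd ρ (fun y => g y β γ) x]

/-- The metric is parallel. -/
lemma pd_metric (hg : IsMetric g ginv) (x : Pt n) (τ μ ν : Fin n) :
    pd τ (fun y => g y μ ν) x =
      ∑ ρ, christoffel g ginv x ρ τ μ * g x ρ ν + ∑ ρ, christoffel g ginv x ρ τ ν * g x μ ρ := by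
  have h1 := sum_metric_mul_christoffel hg x ν τ μ
  have h2 := sum_metric_mul_christoffel hg x μ τ ν
  rw [funext fun y => hg.1 y ν μ, funext fun y => hg.1 y ν τ] at h1
  rw [funext fun y => hg.1 y μ τ] at h2
  simp only [hg.1 x ν] at h1
  simp only [mul_comm (christoffel _ _ _ _ _ _), h1, h2]
  ring

/-- The inverse metric is parallel. -/
lemma pd_inv (hg : IsMetric g ginv) (x : Pt n) (τ μ ν : Fin n) :
    pd τ (fun y => ginv y μ ν) x =
      -∑ ρ, christoffel g ginv x μ τ ρ * ginv x ρ ν -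
        ∑ ρ, christoffel g ginv x ν τ ρ * ginv x μ ρ := by
  set G := Matrix.of (g x) with hG
  set H := Matrix.of (ginv x) with hH
  set A := connEnd g ginv τ x with hA
  set dG : Matrix (Fin n) (Fin n) ℝ := Matrix.of fun μ ν => pd τ (fun y => g y μ ν) x with hdG
  set dH : Matrix (Fin n) (Fin n) ℝ := Matrix.of fun μ ν => pd τ (fun y => ginv y μ ν) x with hdH
  have h1 : dG = A.transpose * G + G * A := by
    ext μ ν
    simp [hdG, hA, hG, pd_metric hg, connEnd, Matrix.mul_apply, mul_comm]
  have h2 : dH * G + H * dG = 0 := by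
    ext μ ν
    have h3 : pd τ (fun y => ∑ ρ, ginv y μ ρ * g y ρ ν) x = 0 := by
      rw [funext fun y => hg.2.2.2 y μ ν, pd_const]
    rw [pd_sum _ _ fun ρ _ => (hg.differentiableAt_inv μ ρ x).fun_mul (hg.differentiableAt ρ ν x)] at h3
    simp only [pd_mul τ (hg.differentiableAt_inv _ _ x) (hg.differentiableAt _ _ x),
      Finset.sum_add_distrib] at h3
    simp only [Matrix.add_apply, Matrix.mul_apply]
    exact h3
  have h4 : dH = -(A * H) - H * A.transpose := by
    have h5 : dH = (dH * G + H * dG) * H - H * dG * H := by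
      rw [add_mul, mul_assoc dH, hg.mul_inv]
      simp
    rw [h5, h2, h1, mul_add, add_mul, ← mul_assoc H G, hg.inv_mul, ← mul_assoc H, mul_assoc _ G H,
      hg.mul_inv]
    simp only [zero_mul, mul_one, one_mul]
    abel
  have h6 := congrFun (congrFun h4 μ) ν
  simpa [hdH, hA, hH, connEnd, Matrix.mul_apply, mul_comm] using h6

/-- The endomorphism field obtained from a tensor field by raising the first index. -/
def raiseEnd (ginv : Pt n → Fin n → Fin n → ℝ) (T : Tensor n (q + 2)) (idx : Fin q → Fin n)
    (x : Pt n) : Matrix (Fin n) (Fin n) ℝ :=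
  Matrix.of fun ρ ν => ∑ σ, ginv x ρ σ * T x (Fin.cons σ (Fin.cons ν idx))

lemma smoothEnd_raiseEnd (hg : IsMetric g ginv) {T : Tensor n (q + 2)} (hT : SmoothTensor T)
    (idx : Fin q → Fin n) : SmoothEnd (raiseEnd ginv T idx) :=
  fun ρ ν => ContDiff.sum (s := Finset.univ) fun σ _ =>
    (hg.2.2.1 ρ σ).mul (hT (Fin.cons σ (Fin.cons ν idx)))

/-- Raising an index commutes with covariant differentiation. -/
lemma covDEnd_raiseEnd (hg : IsMetric g ginv) {T : Tensor n (q + 2)} (hT : SmoothTensor T)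
    (τ : Fin n) (idx : Fin q → Fin n) (x : Pt n) :
    covDEnd g ginv τ (raiseEnd ginv T idx) x =
      raiseEnd ginv (covDAlong g ginv τ T) idx x +
        ∑ i, ∑ κ, christoffel g ginv x κ τ (idx i) •
          raiseEnd ginv T (Function.update idx i κ) x := by
  ext ρ ν
  have hpd : pd τ (fun y => raiseEnd ginv T idx y ρ ν) x =
      ∑ σ, (pd τ (fun y => ginv y ρ σ) x * T x (Fin.cons σ (Fin.cons ν idx)) +
        ginv x ρ σ * pd τ (fun y => T y (Fin.cons σ (Fin.cons ν idx))) x) := by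
    simp only [raiseEnd, Matrix.of_apply]
    rw [pd_sum _ _ fun σ _ => (hg.differentiableAt_inv ρ σ x).fun_mul (hT.differentiableAt _ x)]
    simp only [pd_mul τ (hg.differentiableAt_inv _ _ x) (hT.differentiableAt _ x)]
  have hrest : (∑ i, ∑ κ, christoffel g ginv x κ τ (idx i) •
          raiseEnd ginv T (Function.update idx i κ) x) ρ ν =
      ∑ σ, ginv x ρ σ * derivAct (connEnd g ginv τ x)
        (fun idx => T x (Fin.cons σ (Fin.cons ν idx))) idx := by
    simp only [derivAct, connEnd, raiseEnd, Matrix.sum_apply, Matrix.smul_apply, Matrix.of_apply,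
      smul_eq_mul, Finset.mul_sum]
    conv_rhs => rw [Finset.sum_comm]
    refine Finset.sum_congr rfl fun i _ => ?_
    conv_rhs => rw [Finset.sum_comm]
    exact Finset.sum_congr rfl fun _ _ => Finset.sum_congr rfl fun _ _ => by ring
  have hswap : ∑ σ, (∑ κ, christoffel g ginv x σ τ κ * ginv x ρ κ) *
        T x (Fin.cons σ (Fin.cons ν idx)) =
      ∑ σ, ginv x ρ σ * ∑ κ, christoffel g ginv x κ τ σ * T x (Fin.cons κ (Fin.cons ν idx)) := by
    simp only [Finset.sum_mul, Finset.mul_sum]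
    rw [Finset.sum_comm]
    exact Finset.sum_congr rfl fun _ _ => Finset.sum_congr rfl fun _ _ => by ring
  have hΓM : (connEnd g ginv τ x * raiseEnd ginv T idx x) ρ ν =
      ∑ σ, (∑ κ, christoffel g ginv x ρ τ κ * ginv x κ σ) * T x (Fin.cons σ (Fin.cons ν idx)) := by
    simp only [Matrix.mul_apply, connEnd, raiseEnd, Matrix.of_apply, Finset.sum_mul,
      Finset.mul_sum]
    rw [Finset.sum_comm]
    exact Finset.sum_congr rfl fun _ _ => Finset.sum_congr rfl fun _ _ => by ring
  have hMΓ : (raiseEnd ginv T idx x * connEnd g ginv τ x) ρ ν =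
      ∑ σ, ginv x ρ σ * ∑ κ, christoffel g ginv x κ τ ν * T x (Fin.cons σ (Fin.cons κ idx)) := by
    simp only [Matrix.mul_apply, connEnd, raiseEnd, Matrix.of_apply, Finset.sum_mul,
      Finset.mul_sum]
    rw [Finset.sum_comm]
    exact Finset.sum_congr rfl fun _ _ => Finset.sum_congr rfl fun _ _ => by ring
  rw [covDEnd, Matrix.add_apply, Matrix.sub_apply, Matrix.of_apply, hpd, Matrix.add_apply, hrest,
    hΓM, hMΓ]
  simp only [raiseEnd, Matrix.of_apply, covDAlong_apply, derivAct_cons, connEnd, pd_inv hg,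
    sub_mul, neg_mul, mul_sub, mul_add, Finset.sum_add_distrib, Finset.sum_sub_distrib,
    Finset.sum_neg_distrib, hswap]
  ring

end MetricCompatibility

section Annihilation

variable {n q : ℕ} {g ginv : Pt n → Fin n → Fin n → ℝ}

lemma curvEnd_eq_raiseEnd (hg : IsMetric g ginv) (γ δ : Fin n) (x : Pt n) :
    curvEnd g ginv γ δ x = raiseEnd ginv (riemann g ginv) ![γ, δ] x := by
  ext ρ ν
  exact (sum_inv_mul_metric hg x ρ fun κ => riemannUp g ginv x κ ν γ δ).symm

lemma TwoSymmetric.covDAlong_covDAlong (h2 : TwoSymmetric g ginv) (μ ν : Fin n) (x : Pt n) :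
    covDAlong g ginv μ (covDAlong g ginv ν (riemann g ginv)) x =
      ∑ ρ, christoffel g ginv x ρ μ ν • covDAlong g ginv ρ (riemann g ginv) x := by
  ext idx
  have h := h2 x (Fin.cons μ (Fin.cons ν idx))
  rw [covD_covD_cons_cons, sub_eq_zero] at h
  simpa using h

lemma raiseEnd_sum_smul (c : Fin n → ℝ) (x : Pt n) (S : Tensor n (q + 2))
    (T : Fin n → Tensor n (q + 2)) (h : S x = ∑ κ, c κ • T κ x) (idx : Fin q → Fin n) :
    raiseEnd ginv S idx x = ∑ κ, c κ • raiseEnd ginv (T κ) idx x := by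
  ext ρ ν
  simp only [raiseEnd, Matrix.of_apply, h, Matrix.sum_apply, Matrix.smul_apply, Finset.sum_apply,
    Pi.smul_apply, smul_eq_mul, Finset.mul_sum]
  rw [Finset.sum_comm]
  exact Finset.sum_congr rfl fun _ _ => Finset.sum_congr rfl fun _ _ => by ring

lemma covDAlong_eq_zero_of_eq_zero {T : Tensor n q} (hT : ∀ y, T y = 0) (τ : Fin n) (x : Pt n) :
    covDAlong g ginv τ T x = 0 := by
  ext idx
  simp [covDAlong_apply, hT, derivAct_zero_right, pd_const]

lemma covDAlong_add {S T : Tensor n q} (hS : SmoothTensor S) (hT : SmoothTensor T) (τ : Fin n)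
    (x : Pt n) : covDAlong g ginv τ (fun y => S y + T y) x =
      covDAlong g ginv τ S x + covDAlong g ginv τ T x := by
  ext idx
  simp only [covDAlong_apply, Pi.add_apply, derivAct_add_right,
    pd_add τ (hS.differentiableAt idx x) (hT.differentiableAt idx x)]
  ring

lemma TwoSymmetric.derivAct_riemann (hg : IsMetric g ginv) (h2 : TwoSymmetric g ginv)
    (idx : Fin 2 → Fin n) (x : Pt n) :
    derivAct (raiseEnd ginv (riemann g ginv) idx x) (riemann g ginv x) = 0 := by
  have h := derivAct_curvEnd_eq_zero hg (smoothTensor_riemann hg) h2 (idx 0) (idx 1) x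
  rw [curvEnd_eq_raiseEnd hg] at h
  convert h using 3
  ext i
  fin_cases i <;> rfl

lemma TwoSymmetric.derivAct_covD_riemann (hg : IsMetric g ginv) (h2 : TwoSymmetric g ginv)
    (idx : Fin 2 → Fin n) (x : Pt n) :
    derivAct (raiseEnd ginv (riemann g ginv) idx x) (covD g ginv (riemann g ginv) x) = 0 := by
  have h0 : ∀ x idx, covD g ginv (covD g ginv (covD g ginv (riemann g ginv))) x idx = 0 := by
    intro x idx
    have h := congrFun (covDAlong_eq_zero_of_eq_zero (g := g) (ginv := ginv)
      (fun y => funext (h2 y)) (idx 0) x) (Fin.tail idx)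
    simpa only [covDAlong, Fin.cons_self_tail, Pi.zero_apply] using h
  have h := derivAct_curvEnd_eq_zero hg ((smoothTensor_riemann hg).covD hg) h0 (idx 0) (idx 1) x
  rw [curvEnd_eq_raiseEnd hg] at h
  convert h using 3
  ext i
  fin_cases i <;> rfl

/-- First covariant derivative of the semi-symmetry condition. -/
lemma TwoSymmetric.derivAct_add_derivAct (hg : IsMetric g ginv) (h2 : TwoSymmetric g ginv)
    (τ : Fin n) (idx : Fin 2 → Fin n) (x : Pt n) :
    derivAct (raiseEnd ginv (covDAlong g ginv τ (riemann g ginv)) idx x) (riemann g ginv x) +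
      derivAct (raiseEnd ginv (riemann g ginv) idx x) (covDAlong g ginv τ (riemann g ginv) x) =
      0 := by
  have hR := smoothTensor_riemann hg
  have h := covDAlong_eq_zero_of_eq_zero (g := g) (ginv := ginv) (h2.derivAct_riemann hg idx) τ x
  rw [covDAlong_derivAct (smoothEnd_raiseEnd hg hR idx) hR, covDEnd_raiseEnd hg hR,
    derivAct_add_left] at h
  simpa only [derivAct_sum_left, derivAct_smul_left, h2.derivAct_riemann hg, smul_zero,
    Finset.sum_const_zero, add_zero] using h

/-- Second covariant derivative of the semi-symmetry condition. -/
lemma TwoSymmetric.derivAct_symm (hg : IsMetric g ginv) (h2 : TwoSymmetric g ginv)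
    (τ ν : Fin n) (idx : Fin 2 → Fin n) (x : Pt n) :
    derivAct (raiseEnd ginv (covDAlong g ginv τ (riemann g ginv)) idx x)
        (covDAlong g ginv ν (riemann g ginv) x) +
      derivAct (raiseEnd ginv (covDAlong g ginv ν (riemann g ginv)) idx x)
        (covDAlong g ginv τ (riemann g ginv) x) = 0 := by
  have hR := smoothTensor_riemann hg
  have hS := hR.covDAlong hg τ
  have hB := h2.derivAct_add_derivAct hg
  have h := covDAlong_eq_zero_of_eq_zero (g := g) (ginv := ginv) (hB τ idx) ν x
  have hMR := smoothEnd_raiseEnd hg hR idx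
  have hMS := smoothEnd_raiseEnd hg hS idx
  rw [covDAlong_add (hMS.derivAct hR) (hMR.derivAct hS), covDAlong_derivAct hMS hR,
    covDAlong_derivAct hMR hS, covDEnd_raiseEnd hg hR, covDEnd_raiseEnd hg hS,
    raiseEnd_sum_smul _ x _ (fun κ => covDAlong g ginv κ (riemann g ginv))
      (h2.covDAlong_covDAlong ν τ x), h2.covDAlong_covDAlong ν τ x] at h
  simp only [derivAct_add_left, derivAct_sum_left, derivAct_smul_left, derivAct_sum_right,
    derivAct_smul_right, fun κ idx => eq_neg_of_add_eq_zero_left (hB κ idx x), smul_neg,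
    Finset.sum_neg_distrib] at h
  rw [← h]
  abel

/-- The Ricci identity for the first derivative of the curvature, differentiated once. -/
lemma TwoSymmetric.derivAct_raiseEnd_covD (hg : IsMetric g ginv) (h2 : TwoSymmetric g ginv)
    (τ : Fin n) (idx : Fin 2 → Fin n) (x : Pt n) :
    derivAct (raiseEnd ginv (covDAlong g ginv τ (riemann g ginv)) idx x)
      (covD g ginv (riemann g ginv) x) = 0 := by
  have hR := smoothTensor_riemann hg
  have h0 : covDAlong g ginv τ (covD g ginv (riemann g ginv)) x = 0 :=
    funext fun idx => h2 x (Fin.cons τ idx)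
  have h := covDAlong_eq_zero_of_eq_zero (g := g) (ginv := ginv)
    (h2.derivAct_covD_riemann hg idx) τ x
  rw [covDAlong_derivAct (smoothEnd_raiseEnd hg hR idx) (hR.covD hg), covDEnd_raiseEnd hg hR,
    derivAct_add_left, h0, derivAct_zero_right] at h
  simpa only [derivAct_sum_left, derivAct_smul_left, h2.derivAct_covD_riemann hg, smul_zero,
    Finset.sum_const_zero, add_zero] using h

lemma TwoSymmetric.sum_raiseEnd_mul_covDAlong (hg : IsMetric g ginv) (h2 : TwoSymmetric g ginv)
    (τ ν : Fin n) (idx : Fin 2 → Fin n) (x : Pt n) (J : Fin 4 → Fin n) :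
    ∑ ρ, (raiseEnd ginv (covDAlong g ginv τ (riemann g ginv)) idx x ρ ν +
        raiseEnd ginv (covDAlong g ginv ν (riemann g ginv)) idx x ρ τ) *
      covDAlong g ginv ρ (riemann g ginv) x J = 0 := by
  have h1 := congrFun (h2.derivAct_raiseEnd_covD hg τ idx x) (Fin.cons ν J)
  have h3 := congrFun (h2.derivAct_raiseEnd_covD hg ν idx x) (Fin.cons τ J)
  have h4 := congrFun (h2.derivAct_symm hg τ ν idx x) J
  rw [derivAct_cons] at h1 h3
  simp only [add_mul, Finset.sum_add_distrib]
  simp only [Pi.add_apply, Pi.zero_apply] at h1 h3 h4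
  change _ + derivAct _ (covDAlong g ginv ν (riemann g ginv) x) J = _ at h1
  change _ + derivAct _ (covDAlong g ginv τ (riemann g ginv) x) J = _ at h3
  simp only [covDAlong] at h1 h3 h4 ⊢
  linarith

end Annihilation

section ParallelDirections

variable {n q : ℕ} {g ginv : Pt n → Fin n → Fin n → ℝ}

/-- The covariant derivative of `T` at `x` in the direction of the vector `c` vanishes. -/
def ParallelIn (g ginv : Pt n → Fin n → Fin n → ℝ) (c : Fin n → ℝ) (x : Pt n)
    (T : Tensor n q) : Prop :=
  ∀ idx, ∑ ρ, c ρ * covDAlong g ginv ρ T x idx = 0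

lemma ParallelIn.add {c : Fin n → ℝ} {x : Pt n} {S T : Tensor n q} (hS : SmoothTensor S)
    (hT : SmoothTensor T) (h : ParallelIn g ginv c x S) (h' : ParallelIn g ginv c x T) :
    ParallelIn g ginv c x fun y => S y + T y := fun idx => by
  simp only [covDAlong_add hS hT, Pi.add_apply, mul_add, Finset.sum_add_distrib, h idx, h' idx,
    add_zero]

lemma ParallelIn.const_smul {c : Fin n → ℝ} {x : Pt n} {T : Tensor n q} (hT : SmoothTensor T)
    (h : ParallelIn g ginv c x T) (r : ℝ) : ParallelIn g ginv c x fun y => r • T y := fun idx => by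
  have hr : ∀ ρ, covDAlong g ginv ρ (fun y => r • T y) x idx = r * covDAlong g ginv ρ T x idx := by
    intro ρ
    simp only [covDAlong_apply, derivAct_smul_right, Pi.smul_apply, smul_eq_mul,
      pd_mul ρ (differentiableAt_const r) (hT.differentiableAt idx x), pd_const]
    ring
  simp only [hr, mul_left_comm _ r, ← Finset.mul_sum, h idx, mul_zero]

lemma derivAct_comp_perm (A : Matrix (Fin n) (Fin n) ℝ) (T : (Fin q → Fin n) → ℝ)
    (e : Equiv.Perm (Fin q)) (idx : Fin q → Fin n) :
    derivAct A (fun idx => T (idx ∘ e)) idx = derivAct A T (idx ∘ e) := by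
  simp only [derivAct]
  rw [← Equiv.sum_comp e]
  simp only [Function.update_comp_equiv, Equiv.symm_apply_apply, Function.comp_apply]

lemma ParallelIn.comp_perm {c : Fin n → ℝ} {x : Pt n} {T : Tensor n q}
    (h : ParallelIn g ginv c x T) (e : Equiv.Perm (Fin q)) :
    ParallelIn g ginv c x fun y idx => T y (idx ∘ e) := fun idx => by
  simpa only [covDAlong_apply, derivAct_comp_perm] using h (idx ∘ e)

/-- The metric, viewed as a tensor field. -/
def metricTensor (g : Pt n → Fin n → Fin n → ℝ) : Tensor n 2 := fun x idx => g x (idx 0) (idx 1)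

/-- The tensor product of two tensor fields of rank two. -/
def tensorMul (S T : Tensor n 2) : Tensor n 4 := fun x idx =>
  S x ![idx 0, idx 1] * T x ![idx 2, idx 3]

lemma smoothTensor_metricTensor (hg : IsMetric g ginv) : SmoothTensor (metricTensor g) :=
  fun _ => hg.2.1 _ _

lemma SmoothTensor.tensorMul {S T : Tensor n 2} (hS : SmoothTensor S) (hT : SmoothTensor T) :
    SmoothTensor (tensorMul S T) := fun _ => (hS _).mul (hT _)

lemma derivAct_vec_two (A : Matrix (Fin n) (Fin n) ℝ) (T : (Fin 2 → Fin n) → ℝ) (μ ν : Fin n) :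
    derivAct A T ![μ, ν] = ∑ ρ, A ρ μ * T ![ρ, ν] + ∑ ρ, A ρ ν * T ![μ, ρ] := by
  simp only [derivAct_vecCons, derivAct_rank_zero, add_zero]

lemma covDAlong_metricTensor (hg : IsMetric g ginv) (τ : Fin n) (x : Pt n) :
    covDAlong g ginv τ (metricTensor g) x = 0 := by
  ext idx
  obtain ⟨μ, ν, rfl⟩ : ∃ μ ν, idx = ![μ, ν] :=
    ⟨idx 0, idx 1, by ext i; fin_cases i <;> rfl⟩
  rw [covDAlong_apply, derivAct_vec_two]
  simp only [metricTensor, Matrix.cons_val_zero, Matrix.cons_val_one, pd_metric hg, connEnd,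
    Matrix.of_apply, Pi.zero_apply, sub_self]

lemma covDAlong_tensorMul {S T : Tensor n 2} (hS : SmoothTensor S) (hT : SmoothTensor T)
    (τ : Fin n) (x : Pt n) (idx : Fin 4 → Fin n) :
    covDAlong g ginv τ (tensorMul S T) x idx =
      covDAlong g ginv τ S x ![idx 0, idx 1] * T x ![idx 2, idx 3] +
        S x ![idx 0, idx 1] * covDAlong g ginv τ T x ![idx 2, idx 3] := by
  obtain ⟨α, β, μ, ν, rfl⟩ : ∃ α β μ ν, idx = ![α, β, μ, ν] :=
    ⟨idx 0, idx 1, idx 2, idx 3, by ext i; fin_cases i <;> rfl⟩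
  have hpd : pd τ (fun y => tensorMul S T y ![α, β, μ, ν]) x = _ :=
    pd_mul τ (hS.differentiableAt ![α, β] x) (hT.differentiableAt ![μ, ν] x)
  rw [covDAlong_apply, hpd]
  simp only [covDAlong_apply, derivAct_vecCons, derivAct_rank_zero, tensorMul, Matrix.cons_val,
    add_zero, sub_mul, mul_sub, add_mul, mul_add, Finset.sum_mul, Finset.mul_sum,
    mul_left_comm (S _ _), mul_assoc]
  ring

lemma ParallelIn.tensorMul_metric (hg : IsMetric g ginv) {c : Fin n → ℝ} {x : Pt n}
    {S : Tensor n 2} (hS : SmoothTensor S) (h : ParallelIn g ginv c x S) :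
    ParallelIn g ginv c x (tensorMul S (metricTensor g)) := fun idx => by
  simp only [covDAlong_tensorMul hS (smoothTensor_metricTensor hg), covDAlong_metricTensor hg,
    Pi.zero_apply, mul_zero, add_zero, ← mul_assoc, ← Finset.sum_mul, h ![idx 0, idx 1], zero_mul]

lemma smoothTensor_ricci (hg : IsMetric g ginv) : SmoothTensor (ricci g ginv) :=
  fun _ => ContDiff.sum fun _ _ => contDiff_riemannUp hg _ _ _ _

lemma contDiff_scalarCurv (hg : IsMetric g ginv) : ContDiff ℝ (⊤ : ℕ∞) (scalarCurv g ginv) :=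
  ContDiff.sum fun _ _ => ContDiff.sum fun _ _ => (hg.2.2.1 _ _).mul (smoothTensor_ricci hg _)

lemma pd_endomorphism_entry (M : Pt n → Matrix (Fin n) (Fin n) ℝ) (τ : Fin n) (x : Pt n)
    (α β : Fin n) : pd τ (fun y => M y α β) x =
      covDEnd g ginv τ M x α β - (connEnd g ginv τ x * M x) α β +
        (M x * connEnd g ginv τ x) α β := by
  simp only [covDEnd, Matrix.add_apply, Matrix.sub_apply, Matrix.of_apply]
  ring

lemma pd_trace {M : Pt n → Matrix (Fin n) (Fin n) ℝ} (hM : SmoothEnd M) (τ : Fin n) (x : Pt n) :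
    pd τ (fun y => (M y).trace) x = (covDEnd g ginv τ M x).trace := by
  rw [covDEnd, Matrix.trace_add, Matrix.trace_sub, Matrix.trace_mul_comm (M x), sub_self, add_zero]
  exact pd_sum _ _ fun ρ _ => hM.differentiableAt ρ ρ x

lemma covDAlong_ricci (hg : IsMetric g ginv) (τ μ ν : Fin n) (x : Pt n) :
    covDAlong g ginv τ (ricci g ginv) x ![μ, ν] =
      ∑ ρ, raiseEnd ginv (covDAlong g ginv τ (riemann g ginv)) ![ρ, ν] x ρ μ := by
  have hR := smoothTensor_riemann hg
  have hric : ∀ y μ ν, ricci g ginv y ![μ, ν] =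
      ∑ ρ, raiseEnd ginv (riemann g ginv) ![ρ, ν] y ρ μ := fun y μ ν => by
    simp only [← curvEnd_eq_raiseEnd hg]
    rfl
  rw [covDAlong_apply, derivAct_vec_two]
  simp only [hric]
  rw [pd_sum _ _ fun ρ _ => (smoothEnd_raiseEnd hg hR _).differentiableAt _ _ x]
  simp only [pd_endomorphism_entry (g := g) (ginv := ginv), covDEnd_raiseEnd hg hR,
    Fin.sum_univ_two, Matrix.add_apply, Matrix.sum_apply, Matrix.smul_apply, smul_eq_mul,
    Matrix.mul_apply, connEnd, Matrix.of_apply, Finset.sum_add_distrib, Finset.sum_sub_distrib,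
    Matrix.cons_val_zero, Matrix.cons_val_one, Finset.mul_sum]
  have hfirst : ∀ ρ κ, Function.update ![ρ, ν] 0 κ = ![κ, ν] := fun ρ κ => by
    ext i; fin_cases i <;> rfl
  have hsecond : ∀ ρ κ, Function.update ![ρ, ν] 1 κ = ![ρ, κ] := fun ρ κ => by
    ext i; fin_cases i <;> rfl
  simp only [hfirst, hsecond]
  rw [Finset.sum_comm (f := fun ρ κ => christoffel g ginv x κ τ ρ *
      raiseEnd ginv (riemann g ginv) ![κ, ν] x ρ μ),
    Finset.sum_comm (f := fun ρ κ => christoffel g ginv x κ τ ν *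
      raiseEnd ginv (riemann g ginv) ![ρ, κ] x ρ μ),
    Finset.sum_comm (f := fun ρ κ => raiseEnd ginv (riemann g ginv) ![ρ, ν] x ρ κ *
      christoffel g ginv x κ τ μ)]
  simp only [mul_comm (raiseEnd _ _ _ _ _ _)]
  ring

lemma scalarCurv_eq_trace (hg : IsMetric g ginv) (x : Pt n) :
    scalarCurv g ginv x = (raiseEnd ginv (ricci g ginv) ![] x).trace := by
  rw [scalarCurv, Finset.sum_comm]
  exact Finset.sum_congr rfl fun μ _ => Finset.sum_congr rfl fun ν _ => by
    rw [hg.inv_symm]; rfl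

lemma pd_scalarCurv (hg : IsMetric g ginv) (τ : Fin n) (x : Pt n) :
    pd τ (scalarCurv g ginv) x =
      (raiseEnd ginv (covDAlong g ginv τ (ricci g ginv)) ![] x).trace := by
  have hRic := smoothTensor_ricci hg
  rw [funext (scalarCurv_eq_trace hg), pd_trace (g := g) (ginv := ginv)
    (smoothEnd_raiseEnd hg hRic _), covDEnd_raiseEnd hg hRic]
  simp

lemma ParallelIn.raiseEnd {c : Fin n → ℝ} {x : Pt n} {T : Tensor n (q + 2)}
    (h : ParallelIn g ginv c x T) (idx : Fin q → Fin n) (α β : Fin n) :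
    ∑ ρ, c ρ * raiseEnd ginv (covDAlong g ginv ρ T) idx x α β = 0 := by
  simp only [_root_.raiseEnd, Matrix.of_apply, Finset.mul_sum]
  rw [Finset.sum_comm]
  simp only [mul_left_comm (c _), ← Finset.mul_sum, h _, mul_zero, Finset.sum_const_zero]

lemma ParallelIn.ricci (hg : IsMetric g ginv) {c : Fin n → ℝ} {x : Pt n}
    (h : ParallelIn g ginv c x (riemann g ginv)) : ParallelIn g ginv c x (ricci g ginv) := by
  intro idx
  obtain ⟨μ, ν, rfl⟩ : ∃ μ ν, idx = ![μ, ν] :=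
    ⟨idx 0, idx 1, by ext i; fin_cases i <;> rfl⟩
  simp only [covDAlong_ricci hg, Finset.mul_sum]
  rw [Finset.sum_comm]
  simp only [h.raiseEnd, Finset.sum_const_zero]

lemma ParallelIn.scalarCurv_smul_metric (hg : IsMetric g ginv) {c : Fin n → ℝ} {x : Pt n}
    (h : ParallelIn g ginv c x (_root_.ricci g ginv)) :
    ParallelIn g ginv c x fun y => scalarCurv g ginv y • metricTensor g y := by
  have hs : ∑ ρ, c ρ * pd ρ (scalarCurv g ginv) x = 0 := by
    simp only [pd_scalarCurv hg, Matrix.trace, Matrix.diag_apply, Finset.mul_sum]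
    rw [Finset.sum_comm]
    simp only [h.raiseEnd, Finset.sum_const_zero]
  intro idx
  have hcov : ∀ ρ, covDAlong g ginv ρ (fun y => scalarCurv g ginv y • metricTensor g y) x idx =
      pd ρ (scalarCurv g ginv) x * metricTensor g x idx := by
    intro ρ
    have h0 := congrFun (covDAlong_metricTensor hg ρ x) idx
    rw [covDAlong_apply, Pi.zero_apply] at h0
    simp only [covDAlong_apply, derivAct_smul_right, Pi.smul_apply, smul_eq_mul,
      pd_mul ρ ((contDiff_scalarCurv hg).differentiable (by simp)).differentiableAt
        ((smoothTensor_metricTensor hg).differentiableAt idx x)]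
    linear_combination scalarCurv g ginv x * h0
  simp only [hcov, ← mul_assoc, ← Finset.sum_mul, hs, zero_mul]

end ParallelDirections

section Weyl

variable {n : ℕ} {g ginv : Pt n → Fin n → Fin n → ℝ}

lemma ParallelIn.weyl (hg : IsMetric g ginv) {c : Fin n → ℝ} {x : Pt n}
    (h : ParallelIn g ginv c x (riemann g ginv)) : ParallelIn g ginv c x (weyl g ginv) := by
  have hR := smoothTensor_riemann hg
  have hG := smoothTensor_metricTensor hg
  have hRic := smoothTensor_ricci hg
  have hsG : SmoothTensor fun y => scalarCurv g ginv y • metricTensor g y :=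
    fun idx => (contDiff_scalarCurv hg).mul (hG idx)
  have hRicG := And.intro (hRic.tensorMul hG) ((h.ricci hg).tensorMul_metric hg hRic)
  have hsGG := And.intro (hsG.tensorMul hG)
    (((h.ricci hg).scalarCurv_smul_metric hg).tensorMul_metric hg hsG)
  have term : ∀ {T : Tensor n 4}, SmoothTensor T ∧ ParallelIn g ginv c x T →
      ∀ (r : ℝ) (e : Equiv.Perm (Fin 4)),
      SmoothTensor (fun y => r • fun idx => T y (idx ∘ e)) ∧
        ParallelIn g ginv c x (fun y => r • fun idx => T y (idx ∘ e)) :=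
    fun hT r e => ⟨fun idx => contDiff_const.mul (hT.1 (idx ∘ e)),
      (hT.2.comp_perm e).const_smul (fun idx => hT.1 (idx ∘ e)) r⟩
  have add : ∀ {S T : Tensor n 4}, SmoothTensor S ∧ ParallelIn g ginv c x S →
      SmoothTensor T ∧ ParallelIn g ginv c x T →
      SmoothTensor (fun y => S y + T y) ∧ ParallelIn g ginv c x fun y => S y + T y :=
    fun hS hT => ⟨fun idx => (hS.1 idx).add (hT.1 idx), hS.2.add hS.1 hT.1 hT.2⟩
  set a : ℝ := 1 / ((n : ℝ) - 2) with ha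
  set b : ℝ := 1 / (((n : ℝ) - 1) * ((n : ℝ) - 2)) with hb
  let e₁ : Equiv.Perm (Fin 4) := ⟨![0, 2, 3, 1], ![0, 3, 1, 2], by decide, by decide⟩
  let e₂ : Equiv.Perm (Fin 4) := ⟨![0, 3, 2, 1], ![0, 3, 2, 1], by decide, by decide⟩
  let e₃ : Equiv.Perm (Fin 4) := ⟨![1, 2, 3, 0], ![3, 0, 1, 2], by decide, by decide⟩
  let e₄ : Equiv.Perm (Fin 4) := ⟨![1, 3, 2, 0], ![3, 0, 2, 1], by decide, by decide⟩
  let e₅ : Equiv.Perm (Fin 4) := ⟨![0, 2, 1, 3], ![0, 2, 1, 3], by decide, by decide⟩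
  let e₆ : Equiv.Perm (Fin 4) := ⟨![0, 3, 1, 2], ![0, 2, 3, 1], by decide, by decide⟩
  have key := add ⟨hR, h⟩ <| add (term hRicG (-a) e₁) <| add (term hRicG a e₂) <|
    add (term hRicG a e₃) <| add (term hRicG (-a) e₄) <| add (term hsGG b e₅) (term hsGG (-b) e₆)
  convert key.2 using 1
  ext y idx
  simp [_root_.weyl, tensorMul, metricTensor, e₁, e₂, e₃, e₄, e₅, e₆, ha, hb, div_eq_mul_inv]
  ring

end Weyl

/-- In any `n`-dimensional 2-symmetric semi-Riemannian manifold of any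
signature (`n > 2`), the symmetrized first derivative of the Riemann tensor annihilates
the first derivatives of the curvature tensors:
`∇_(τ R^ρ_{ν)λμ} ∇_ρ R_{αβγδ} = 0`, `∇_(τ R^ρ_{ν)λμ} ∇_ρ C_{αβγδ} = 0` and
`∇_(τ R^ρ_{ν)λμ} ∇_ρ R_{αβ} = 0`. -/
theorem stmt7 {n : ℕ} (hn : 2 < n) (g ginv : Pt n → Fin n → Fin n → ℝ)
    (hg : IsMetric g ginv) (h2 : TwoSymmetric g ginv) :
    (∀ (x : Pt n) (τ ν lam μ α β γ δ : Fin n),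
      (∑ ρ, ∑ σ, ginv x ρ σ *
        ((covD g ginv (riemann g ginv) x ![τ, σ, ν, lam, μ] +
          covD g ginv (riemann g ginv) x ![ν, σ, τ, lam, μ]) / 2) *
        covD g ginv (riemann g ginv) x ![ρ, α, β, γ, δ]) = 0) ∧
    (∀ (x : Pt n) (τ ν lam μ α β γ δ : Fin n),
      (∑ ρ, ∑ σ, ginv x ρ σ *
        ((covD g ginv (riemann g ginv) x ![τ, σ, ν, lam, μ] +
          covD g ginv (riemann g ginv) x ![ν, σ, τ, lam, μ]) / 2) *
        covD g ginv (weyl g ginv) x ![ρ, α, β, γ, δ]) = 0) ∧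
    (∀ (x : Pt n) (τ ν lam μ α β : Fin n),
      (∑ ρ, ∑ σ, ginv x ρ σ *
        ((covD g ginv (riemann g ginv) x ![τ, σ, ν, lam, μ] +
          covD g ginv (riemann g ginv) x ![ν, σ, τ, lam, μ]) / 2) *
        covD g ginv (ricci g ginv) x ![ρ, α, β]) = 0) := by

  have hpar : ∀ (x : Pt n) (τ ν lam μ : Fin n), ParallelIn g ginv (fun ρ => ∑ σ, ginv x ρ σ *
      ((covD g ginv (riemann g ginv) x ![τ, σ, ν, lam, μ] +
        covD g ginv (riemann g ginv) x ![ν, σ, τ, lam, μ]) / 2)) x (riemann g ginv) := by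
    intro x τ ν lam μ J
    have h := h2.sum_raiseEnd_mul_covDAlong hg τ ν ![lam, μ] x J
    have hc : ∀ ρ, (∑ σ, ginv x ρ σ *
        ((covD g ginv (riemann g ginv) x ![τ, σ, ν, lam, μ] +
          covD g ginv (riemann g ginv) x ![ν, σ, τ, lam, μ]) / 2)) = (1 / 2) *
        (raiseEnd ginv (covDAlong g ginv τ (riemann g ginv)) ![lam, μ] x ρ ν +
          raiseEnd ginv (covDAlong g ginv ν (riemann g ginv)) ![lam, μ] x ρ τ) := by
      intro ρ
      simp only [raiseEnd, Matrix.of_apply]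
      rw [← Finset.sum_add_distrib, Finset.mul_sum]
      refine Finset.sum_congr rfl fun σ _ => ?_
      change _ = 1 / 2 * (ginv x ρ σ * covD g ginv (riemann g ginv) x ![τ, σ, ν, lam, μ] +
        ginv x ρ σ * covD g ginv (riemann g ginv) x ![ν, σ, τ, lam, μ])
      ring
    simp only [hc, mul_assoc, ← Finset.mul_sum, h, mul_zero]
  simp only [← Finset.sum_mul]
  exact ⟨fun x τ ν lam μ α β γ δ => hpar x τ ν lam μ ![α, β, γ, δ],
    fun x τ ν lam μ α β γ δ => (hpar x τ ν lam μ).weyl hg ![α, β, γ, δ],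
    fun x τ ν lam μ α β => (hpar x τ ν lam μ).ricci hg ![α, β]⟩
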